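/- arXiv:2504.14323 — 5 statements merged into one kernel-verified Lean document; each statement's English description precedes it below -/
import Mathlib

section
/- Let T be a tree of finite sequences of natural numbers. The Kleene–Brouwer order <KB restricted to T is well-founded if and only if T has no infinite path, i.e. [T] = ∅. (Since <KB is a linear order, equivalently: <KB restricted to T is a well-order iff [T] = ∅.) -/
/-- The initial segment of `g` of length `n`, as a finite sequence. -/
def initSeg (g : ℕ → ℕ) (n : ℕ) : List ℕ := (List.range n).map g

/-- A tree: a set of finite sequences closed under initial segments. -/
def IsTree (T : Set (List ℕ)) : Prop := ∀ σ ∈ T, ∀ τ, τ <+: σ → τ ∈ T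

/-- `[T]` for a tree `T`: the set of infinite paths. -/
def treePaths (T : Set (List ℕ)) : Set (ℕ → ℕ) := {g | ∀ n, initSeg g n ∈ T}

/-- `σ` is left of `τ`: they are incomparable and at the first position where they
differ, `σ` has the smaller value. -/
def LeftOf (σ τ : List ℕ) : Prop := ∃ ρ x y, x < y ∧ ρ ++ [x] <+: σ ∧ ρ ++ [y] <+: τ

/-- The Kleene–Brouwer order: `σ <KB τ` iff `σ` properly extends `τ` or `σ` is left
of `τ`. -/
def KBlt (σ τ : List ℕ) : Prop := (τ <+: σ ∧ σ ≠ τ) ∨ LeftOf σ τ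

theorem initSeg_succ (g : ℕ → ℕ) (n : ℕ) : initSeg g (n + 1) = initSeg g n ++ [g n] := by
  simp [initSeg, List.range_succ]

/-- A property of the empty sequence that always passes to some one-step extension holds
along an infinite sequence. -/
theorem exists_forall_initSeg {B : List ℕ → Prop} (h0 : B [])
    (hs : ∀ ρ, B ρ → ∃ x, B (ρ ++ [x])) : ∃ g, ∀ n, B (initSeg g n) := by
  choose! f hf using hs
  let s : ℕ → List ℕ := fun n => Nat.rec [] (fun _ ρ => ρ ++ [f ρ]) n
  have hseg : ∀ n, initSeg (fun k => f (s k)) n = s n := by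
    intro n
    induction n with
    | zero => rfl
    | succ n ih => rw [initSeg_succ, ih]
  refine ⟨fun k => f (s k), fun n => ?_⟩
  rw [hseg]
  induction n with
  | zero => exact h0
  | succ n ih => exact hf _ ih

theorem not_leftOf_nil (σ : List ℕ) : ¬ LeftOf σ [] := by
  rintro ⟨ρ, x, y, -, -, h⟩
  simp at h

theorem LeftOf.of_append_singleton {σ ρ : List ℕ} {x : ℕ} (h : LeftOf σ (ρ ++ [x])) :
    LeftOf σ ρ ∨ ∃ y < x, ρ ++ [y] <+: σ := by
  obtain ⟨π, a, b, hab, hσ, hρ⟩ := h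
  rcases List.prefix_concat_iff.1 hρ with h | h
  · obtain ⟨rfl, hb⟩ := List.append_inj' h rfl
    obtain rfl : b = x := by simpa using hb
    exact .inr ⟨a, hab, hσ⟩
  · exact .inl ⟨π, a, b, hab, hσ, h⟩

theorem exists_append_singleton_prefix {σ ρ : List ℕ} (h : ρ <+: σ) (hne : σ ≠ ρ) :
    ∃ x, ρ ++ [x] <+: σ := by
  obtain ⟨t, rfl⟩ := h
  cases t with
  | nil => simp at hne
  | cons x t => exact ⟨x, t, by simp⟩

/-- If everything in `T` to the left of `ρ` is accessible for the Kleene–Brouwer order but `ρ`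
is not, then the same holds of some one-step extension of `ρ`. -/
theorem exists_child_not_acc {T : Set (List ℕ)} (hT : IsTree T) {ρ : List ℕ} (hρ : ρ ∈ T)
    (hleft : ∀ σ : T, LeftOf σ ρ → Acc (fun a b : T => KBlt a.1 b.1) σ)
    (hacc : ¬ Acc (fun a b : T => KBlt a.1 b.1) ⟨ρ, hρ⟩) :
    ∃ (x : ℕ) (hx : ρ ++ [x] ∈ T),
      (∀ σ : T, LeftOf σ (ρ ++ [x]) → Acc (fun a b : T => KBlt a.1 b.1) σ) ∧
      ¬ Acc (fun a b : T => KBlt a.1 b.1) ⟨ρ ++ [x], hx⟩ := by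
  by_contra! hcon
  have hext : ∀ (x : ℕ) (σ : T), ρ ++ [x] <+: σ.1 →
      Acc (fun a b : T => KBlt a.1 b.1) σ := by
    intro x
    induction x using Nat.strong_induction_on with
    | _ x ih =>
      intro σ hσ
      have hx : ρ ++ [x] ∈ T := hT _ σ.2 _ hσ
      have hchild := hcon x hx fun τ hτ => by
        rcases hτ.of_append_singleton with h | ⟨y, hy, h⟩
        · exact hleft τ h
        · exact ih y hy τ h
      by_cases he : σ = ⟨ρ ++ [x], hx⟩
      · rwa [he]
      · exact hchild.inv (.inl ⟨hσ, fun h => he (Subtype.ext h)⟩)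
  refine hacc ⟨_, fun σ hσ => ?_⟩
  rcases hσ with ⟨hp, hne⟩ | h
  · obtain ⟨x, hx⟩ := exists_append_singleton_prefix hp hne
    exact hext x σ hx
  · exact hleft σ h

/-- The Kleene–Brouwer order restricted to a tree `T` is well-founded iff `T` has no
infinite path. -/
theorem stmt3 (T : Set (List ℕ)) (hT : IsTree T) :
    WellFounded (fun a b : ↥T => KBlt a.1 b.1) ↔ treePaths T = ∅ := by
  constructor
  · intro hwf
    refine Set.eq_empty_of_forall_notMem fun g hg => ?_
    refine (wellFounded_iff_isEmpty_descending_chain.1 hwf).false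
      ⟨fun n => ⟨initSeg g n, hg n⟩, fun n => .inl ?_⟩
    simp [initSeg_succ]
  · intro hpaths
    refine ⟨fun σ => ?_⟩
    have hnil : [] ∈ T := hT _ σ.2 _ List.nil_prefix
    have hroot : Acc (fun a b : T => KBlt a.1 b.1) ⟨[], hnil⟩ := by
      by_contra hacc
      obtain ⟨g, hg⟩ := exists_forall_initSeg
        (B := fun ρ => ∃ hρ : ρ ∈ T,
          (∀ σ : T, LeftOf σ ρ → Acc (fun a b : T => KBlt a.1 b.1) σ) ∧
          ¬ Acc (fun a b : T => KBlt a.1 b.1) ⟨ρ, hρ⟩)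
        ⟨hnil, fun σ h => (not_leftOf_nil _ h).elim, hacc⟩
        fun _ ⟨hρ, hleft, h⟩ => exists_child_not_acc hT hρ hleft h
      exact Set.eq_empty_iff_forall_notMem.1 hpaths g fun n => (hg n).1
    by_cases he : σ = ⟨[], hnil⟩
    · rwa [he]
    · exact hroot.inv (.inl ⟨List.nil_prefix, fun h => he (Subtype.ext h)⟩)
end

section
/- Let T be a tree of finite sequences of natural numbers and let f be the leftmost path through T, i.e. f ∈ [T] and for every g ∈ [T] either g = f or f ◁ g. Set T_{◁f} := { σ ∈ T : σ ◁ f }. Then: (i) the Kleene–Brouwer order <KB is well-founded on T_{◁f}; (ii) T_{◁f} is an initial segment of T under <KB, i.e. if σ ∈ T_{◁f}, τ ∈ T and τ <KB σ then τ ∈ T_{◁f}; and (iii) T_{◁f} is the maximal well-founded initial segment: every S ⊆ T that is an initial segment of T under <KB and on which <KB is well-founded satisfies S ⊆ T_{◁f}. -/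
/-- `f` is left of `g` (functions). -/
def funLeftOf (f g : ℕ → ℕ) : Prop := ∃ n, (∀ i, i < n → f i = g i) ∧ f n < g n

/-- The finite sequence `σ` is left of the function `f`: `σ` is not an initial
segment of `f` and at the first position where they differ `σ` has the smaller
value. -/
def listLeftOfFun (σ : List ℕ) (f : ℕ → ℕ) : Prop :=
  ∃ ρ x, x < f ρ.length ∧ ρ ++ [x] <+: σ ∧ ρ = initSeg f ρ.length

theorem length_initSeg (g : ℕ → ℕ) (n : ℕ) : (initSeg g n).length = n := by
  simp [initSeg]

theorem initSeg_prefix (g : ℕ → ℕ) {m n : ℕ} (h : m ≤ n) : initSeg g m <+: initSeg g n := by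
  induction n, h using Nat.le_induction with
  | base => exact List.prefix_rfl
  | succ n _ ih => exact ih.trans (initSeg_succ g n ▸ List.prefix_append _ _)

theorem initSeg_congr {f g : ℕ → ℕ} {n : ℕ} (h : ∀ i < n, f i = g i) :
    initSeg f n = initSeg g n :=
  List.map_congr_left fun i hi => h i (List.mem_range.1 hi)

theorem append_singleton_inj_of_prefix {ρ σ : List ℕ} {x y : ℕ}
    (hx : ρ ++ [x] <+: σ) (hy : ρ ++ [y] <+: σ) : x = y := by
  have h := List.prefix_of_prefix_length_le hx hy (by simp)
  simpa using h.eq_of_length (by simp)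

theorem prefix_append_singleton {ρ σ : List ℕ} {y : ℕ} (h : σ <+: ρ ++ [y]) :
    σ = ρ ++ [y] ∨ σ <+: ρ := by
  simpa [List.prefix_concat_iff] using h

theorem LeftOf.mono {σ σ' τ τ' : List ℕ} (h : LeftOf σ τ) (hσ : σ <+: σ') (hτ : τ <+: τ') :
    LeftOf σ' τ' := by
  obtain ⟨ρ, x, y, hxy, hx, hy⟩ := h
  exact ⟨ρ, x, y, hxy, hx.trans hσ, hy.trans hτ⟩

theorem exists_initSeg_append_prefix (σ : List ℕ) (f : ℕ → ℕ) :
    σ = initSeg f σ.length ∨ ∃ n x, x ≠ f n ∧ initSeg f n ++ [x] <+: σ := by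
  induction σ using List.reverseRecOn with
  | nil => exact .inl rfl
  | append_singleton σ a ih =>
    rcases ih with ih | ⟨n, x, hx, h⟩
    · by_cases ha : a = f σ.length
      · left
        rw [List.length_append, List.length_singleton, initSeg_succ, ← ih, ha]
      · exact .inr ⟨σ.length, a, ha, by rw [← ih]⟩
    · exact .inr ⟨n, x, hx, h.trans (List.prefix_append _ _)⟩

theorem listLeftOfFun_iff {σ : List ℕ} {f : ℕ → ℕ} :
    listLeftOfFun σ f ↔ ∃ n, LeftOf σ (initSeg f n) := by
  constructor
  · rintro ⟨ρ, x, hx, hσ, hρ⟩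
    exact ⟨ρ.length + 1, ρ, x, _, hx, hσ, by rw [initSeg_succ, ← hρ]⟩
  · rintro ⟨n, ρ, x, y, hxy, hσ, hρ⟩
    have hlen : ρ.length + 1 ≤ n := by simpa [length_initSeg] using hρ.length_le
    have h := (List.prefix_of_prefix_length_le hρ (initSeg_prefix f hlen)
      (by simp [length_initSeg])).eq_of_length (by simp [length_initSeg])
    rw [initSeg_succ] at h
    obtain ⟨h₁, h₂⟩ := List.append_inj' h rfl
    refine ⟨ρ, x, ?_, hσ, h₁⟩
    rw [List.singleton_inj] at h₂
    omega

theorem LeftOf.trans {σ τ υ : List ℕ} (h₁ : LeftOf σ τ) (h₂ : LeftOf τ υ) : LeftOf σ υ := by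
  obtain ⟨ρ, a, b, hab, ha, hb⟩ := h₁
  obtain ⟨ρ', x, y, hxy, hx, hy⟩ := h₂
  rcases lt_trichotomy ρ.length ρ'.length with h | h | h
  · have hp : ρ ++ [b] <+: ρ' := List.prefix_of_prefix_length_le hb
      ((List.prefix_append _ _).trans hx) (by simpa using h)
    exact ⟨ρ, a, b, hab, ha, hp.trans ((List.prefix_append _ _).trans hy)⟩
  · have hp : ρ = ρ' := (List.prefix_of_prefix_length_le ((List.prefix_append _ _).trans hb)
      ((List.prefix_append _ _).trans hx) h.le).eq_of_length h
    subst hp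
    have := append_singleton_inj_of_prefix hb hx
    exact ⟨ρ, a, y, by omega, ha, hy⟩
  · have hp : ρ' ++ [x] <+: ρ := List.prefix_of_prefix_length_le hx
      ((List.prefix_append _ _).trans hb) (by simpa using h)
    exact ⟨ρ', x, y, hxy, hp.trans ((List.prefix_append _ _).trans ha), hy⟩

/-- A nonempty set of finite sequences without `<KB`-minimal element has a leftmost branch:
a function all of whose initial segments extend to elements of the set, and such that no element
of the set is to the left of it. -/
theorem exists_leftmost_branch {A : Set (List ℕ)} (hne : A.Nonempty)
    (hmin : ∀ a ∈ A, ∃ b ∈ A, KBlt b a) :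
    ∃ g : ℕ → ℕ, ∀ n, (∃ a ∈ A, initSeg g n <+: a) ∧ ∀ a ∈ A, ¬ LeftOf a (initSeg g n) := by
  let L : List ℕ → Prop := fun σ => (∃ a ∈ A, σ <+: a) ∧ ∀ a ∈ A, ¬ LeftOf a σ
  have step : ∀ σ : {σ // L σ}, ∃ x, L (σ.1 ++ [x]) := by
    rintro ⟨σ, ⟨a, ha, hσa⟩, hl⟩
    have hex : ∃ x, ∃ b ∈ A, σ ++ [x] <+: b := by
      have key : ∀ b ∈ A, σ <+: b → b ≠ σ → ∃ x, ∃ b ∈ A, σ ++ [x] <+: b := by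
        rintro b hb ⟨_ | ⟨x, t⟩, rfl⟩ hne
        · simp at hne
        · exact ⟨x, _, hb, t, by simp⟩
      by_cases h : a = σ
      · subst h
        obtain ⟨b, hb, ⟨hab, hne⟩ | hlt⟩ := hmin a ha
        · exact key b hb hab hne
        · exact absurd hlt (hl b hb)
      · exact key a ha hσa h
    classical
    refine ⟨Nat.find hex, Nat.find_spec hex, ?_⟩
    rintro b hb ⟨ρ, x, y, hxy, hx, hy⟩
    rcases prefix_append_singleton hy with h | h
    · obtain ⟨rfl, h₂⟩ := List.append_inj' h rfl
      rw [List.singleton_inj] at h₂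
      exact Nat.find_min hex (h₂ ▸ hxy) ⟨b, hb, hx⟩
    · exact hl b hb ⟨ρ, x, y, hxy, hx, h⟩
  choose next hnext using step
  have hnil : L [] := by
    refine ⟨hne.imp fun a ha => ⟨ha, List.nil_prefix⟩, ?_⟩
    rintro b - ⟨ρ, x, y, -, -, hy⟩
    simp at hy
  let s : ℕ → {σ // L σ} := fun n => Nat.rec ⟨[], hnil⟩ (fun _ σ => ⟨_, hnext σ⟩) n
  have hs : ∀ n, initSeg (fun k => next (s k)) n = (s n).1 := by
    intro n
    induction n with
    | zero => rfl
    | succ n ih => rw [initSeg_succ, ih]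
  exact ⟨fun k => next (s k), fun n => hs n ▸ (s n).2⟩

theorem wellFounded_KBlt_of_forall_leftOf {T : Set (List ℕ)} (hT : IsTree T) {f : ℕ → ℕ}
    (hleft : ∀ g ∈ treePaths T, g = f ∨ funLeftOf f g) :
    WellFounded (fun a b : ↥{σ | σ ∈ T ∧ listLeftOfFun σ f} => KBlt a.1 b.1) := by
  rw [WellFounded.wellFounded_iff_has_min]
  intro B hB
  by_contra! hmin
  obtain ⟨g, hg⟩ := exists_leftmost_branch (A := Subtype.val '' B) (hB.image _) (by
    rintro _ ⟨a, ha, rfl⟩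
    obtain ⟨b, hb, hlt⟩ := hmin a ha
    exact ⟨b, ⟨b, hb, rfl⟩, hlt⟩)
  have hgT : g ∈ treePaths T := by
    intro n
    obtain ⟨_, ⟨a, -, rfl⟩, hga⟩ := (hg n).1
    exact hT _ a.2.1 _ hga
  obtain ⟨a, ha⟩ := hB
  have hla : ∀ n, ¬ LeftOf a.1 (initSeg g n) := fun n => (hg n).2 _ ⟨a, ha, rfl⟩
  obtain ⟨n, hn⟩ := listLeftOfFun_iff.1 a.2.2
  rcases hleft g hgT with rfl | ⟨m, hm, hlt⟩
  · exact hla n hn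
  · have hfg : LeftOf (initSeg f (m + 1)) (initSeg g (m + 1)) :=
      ⟨initSeg f m, f m, g m, hlt, by rw [initSeg_succ],
        by rw [initSeg_succ, initSeg_congr hm]⟩
    have h₁ := hn.mono List.prefix_rfl (initSeg_prefix f (le_max_left n (m + 1)))
    have h₂ := hfg.mono (initSeg_prefix f (le_max_right n (m + 1))) List.prefix_rfl
    exact hla _ (h₁.trans h₂)

theorem listLeftOfFun.of_KBlt {σ τ : List ℕ} {f : ℕ → ℕ} (hσ : listLeftOfFun σ f)
    (h : KBlt τ σ) : listLeftOfFun τ f := by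
  obtain ⟨n, hn⟩ := listLeftOfFun_iff.1 hσ
  refine listLeftOfFun_iff.2 ⟨n, ?_⟩
  rcases h with ⟨h, -⟩ | h
  · exact hn.mono h List.prefix_rfl
  · exact h.trans hn

theorem exists_forall_initSeg_KBlt {σ : List ℕ} {f : ℕ → ℕ} (hσ : ¬ listLeftOfFun σ f) :
    ∃ N, ∀ n ≥ N, KBlt (initSeg f n) σ := by
  rcases exists_initSeg_append_prefix σ f with h | ⟨n, x, hx, h⟩
  · refine ⟨σ.length + 1, fun n hn => .inl ⟨?_, ?_⟩⟩
    · rw [h]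
      exact initSeg_prefix f (by omega)
    · rintro rfl
      rw [length_initSeg] at hn
      omega
  · have hfx : f n < x := by
      refine lt_of_le_of_ne (not_lt.1 fun hlt => hσ ?_) hx.symm
      exact listLeftOfFun_iff.2 ⟨n + 1, _, x, f n, hlt, h, by rw [initSeg_succ]⟩
    refine ⟨n + 1, fun k hk => .inr ⟨_, f n, x, hfx, ?_, h⟩⟩
    rw [← initSeg_succ]
    exact initSeg_prefix f hk

/-- If `f` is the leftmost path of a tree `T`, then `T_{◁f} = {σ ∈ T : σ ◁ f}` is:
(i) well-founded under the Kleene–Brouwer order; (ii) an initial segment of `T`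
under `<KB`; and (iii) maximal among well-founded `<KB`-initial segments of `T`. -/
theorem stmt6 (T : Set (List ℕ)) (hT : IsTree T) (f : ℕ → ℕ)
    (hf : f ∈ treePaths T)
    (hleft : ∀ g ∈ treePaths T, g = f ∨ funLeftOf f g) :
    WellFounded (fun a b : ↥{σ | σ ∈ T ∧ listLeftOfFun σ f} => KBlt a.1 b.1) ∧
    (∀ σ, σ ∈ T ∧ listLeftOfFun σ f → ∀ τ ∈ T, KBlt τ σ → τ ∈ T ∧ listLeftOfFun τ f) ∧
    (∀ S : Set (List ℕ), S ⊆ T →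
      (∀ σ ∈ S, ∀ τ ∈ T, KBlt τ σ → τ ∈ S) →
      WellFounded (fun a b : ↥S => KBlt a.1 b.1) →
      S ⊆ {σ | σ ∈ T ∧ listLeftOfFun σ f}) := by
  refine ⟨wellFounded_KBlt_of_forall_leftOf hT hleft,
    fun σ hσ τ hτ h => ⟨hτ, hσ.2.of_KBlt h⟩, fun S hST hinit hwf σ hσ => ⟨hST hσ, ?_⟩⟩
  by_contra hn
  obtain ⟨N, hN⟩ := exists_forall_initSeg_KBlt hn
  have hS : ∀ k, initSeg f (N + k) ∈ S := fun k =>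
    hinit σ hσ _ (hf _) (hN _ (Nat.le_add_right N k))
  obtain ⟨_, ⟨k, rfl⟩, hk⟩ := hwf.has_min (Set.range fun k => (⟨_, hS k⟩ : ↥S)) ⟨_, 0, rfl⟩
  refine hk _ ⟨k + 1, rfl⟩ (.inl ⟨initSeg_prefix f (by omega), fun h => ?_⟩)
  have := congrArg List.length h
  simp only [length_initSeg] at this
  omega
end

section
/- Let T be a tree of finite sequences of natural numbers and let ν ∈ T⁺ be such that ν followed by k zeros is not in T for some k ≥ 0. Then η(ν) is defined and satisfies: η(ν) ∈ T⁺ \ T, η(ν) extends ν (possibly η(ν) = ν), no element of T⁺ properly extends η(ν), and η(ν) is the <KB-least element of { τ ∈ T⁺ : τ extends ν }: for every τ ∈ T⁺ extending ν, either τ = η(ν) or η(ν) <KB τ. -/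
/-- `T⁺ = T ∪ { σ⌢⟨n⟩ : σ ∈ T, n ∈ ℕ }`. -/
def treePlus (T : Set (List ℕ)) : Set (List ℕ) :=
  T ∪ {σ | ∃ τ ∈ T, ∃ n : ℕ, σ = τ ++ [n]}

theorem LeftOf.append_left {σ τ : List ℕ} (h : LeftOf σ τ) (ν : List ℕ) :
    LeftOf (ν ++ σ) (ν ++ τ) := by
  obtain ⟨ρ, x, y, hxy, hσ, hτ⟩ := h
  refine ⟨ν ++ ρ, x, y, hxy, ?_, ?_⟩ <;> rw [List.append_assoc]
  · exact (List.prefix_append_right_inj ν).2 hσ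
  · exact (List.prefix_append_right_inj ν).2 hτ

/-- Nothing is left of a sequence of zeros. -/
theorem replicate_zero_prefix_or_leftOf (k : ℕ) (s : List ℕ) :
    s <+: List.replicate k 0 ∨ List.replicate k 0 <+: s ∨ LeftOf (List.replicate k 0) s := by
  induction k generalizing s with
  | zero => exact Or.inr (Or.inl List.nil_prefix)
  | succ k ih =>
    match s with
    | [] => exact Or.inl List.nil_prefix
    | 0 :: s =>
      rw [List.replicate_succ]
      rcases ih s with h | h | h
      · exact Or.inl ((List.prefix_append_right_inj [0]).2 h)
      · exact Or.inr (Or.inl ((List.prefix_append_right_inj [0]).2 h))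
      · exact Or.inr (Or.inr (h.append_left [0]))
    | (n + 1) :: s =>
      exact Or.inr (Or.inr ⟨[], 0, n + 1, n.succ_pos, ⟨List.replicate k 0, rfl⟩, ⟨s, rfl⟩⟩)

/-- An element of `T⁺` extending a sequence outside `T` equals that sequence. -/
theorem IsTree.eq_of_prefix_of_notMem {T : Set (List ℕ)} (hT : IsTree T) {σ τ : List ℕ}
    (hσ : σ ∉ T) (hτ : τ ∈ treePlus T) (h : σ <+: τ) : τ = σ := by
  rcases hτ with hτ | ⟨ρ, hρ, n, rfl⟩
  · exact absurd (hT τ hτ σ h) hσ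
  · rcases List.prefix_concat_iff.1 h with h | h
    · exact h.symm
    · exact absurd (hT ρ hρ σ h) hσ

/-- If `ν ∈ T⁺` and `k` is least with `ν⌢0ᵏ ∉ T`, then `η(ν) := ν⌢0ᵏ` satisfies:
`η(ν) ∈ T⁺ \ T`, `η(ν)` extends `ν`, no element of `T⁺` properly extends `η(ν)`, and
`η(ν)` is the `<KB`-least element of `T⁺` extending `ν`. -/
theorem stmt8 (T : Set (List ℕ)) (hT : IsTree T) (ν : List ℕ) (hν : ν ∈ treePlus T)
    (k : ℕ) (hk : ν ++ List.replicate k 0 ∉ T)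
    (hmin : ∀ j, j < k → ν ++ List.replicate j 0 ∈ T) :
    (ν ++ List.replicate k 0) ∈ treePlus T ∧
    (ν ++ List.replicate k 0) ∉ T ∧
    ν <+: (ν ++ List.replicate k 0) ∧
    (∀ τ ∈ treePlus T, (ν ++ List.replicate k 0) <+: τ → τ = ν ++ List.replicate k 0) ∧
    (∀ τ ∈ treePlus T, ν <+: τ →
      τ = ν ++ List.replicate k 0 ∨ KBlt (ν ++ List.replicate k 0) τ) := by
  have hmax : ∀ τ ∈ treePlus T, (ν ++ List.replicate k 0) <+: τ → τ = ν ++ List.replicate k 0 :=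
    fun _ hτ h => hT.eq_of_prefix_of_notMem hk hτ h
  refine ⟨?_, hk, List.prefix_append _ _, hmax, ?_⟩
  · cases k with
    | zero => simpa using hν
    | succ k =>
      exact Or.inr ⟨_, hmin k k.lt_succ_self, 0, by rw [List.replicate_succ', List.append_assoc]⟩
  · rintro _ hτ ⟨s, rfl⟩
    rcases replicate_zero_prefix_or_leftOf k s with h | h | h
    · by_cases he : ν ++ s = ν ++ List.replicate k 0
      · exact Or.inl he
      · exact Or.inr (Or.inl ⟨(List.prefix_append_right_inj ν).2 h, Ne.symm he⟩)
    · exact Or.inl (hmax _ hτ ((List.prefix_append_right_inj ν).2 h))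
    · exact Or.inr (Or.inr (h.append_left ν))
end

section
/- Let T be a tree of finite sequences of natural numbers, let σ ∈ T⁺ be nonempty with last entry x (so σ = σ⁻⌢⟨x⟩, where σ⁻ is the immediate predecessor of σ under the initial-segment relation and σ⁻ ∈ T), and suppose that σ⁻⌢⟨x+1⟩ followed by k zeros is not in T for some k ≥ 0. Then σ⁺ := η(σ⁻⌢⟨x+1⟩) is defined, σ⁺ ∈ T⁺ \ T, and σ⁺ is the immediate successor of σ in T⁺ under the Kleene–Brouwer order: σ <KB σ⁺ and there is no τ ∈ T⁺ with σ <KB τ <KB σ⁺. -/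
theorem not_leftOf_nil_left (t : List ℕ) : ¬ LeftOf [] t := by
  rintro ⟨ρ, x, y, -, h, -⟩
  simp at h

theorem not_leftOf_nil_right (s : List ℕ) : ¬ LeftOf s [] := by
  rintro ⟨ρ, x, y, -, -, h⟩
  simp at h

theorem leftOf_cons_cons {a b : ℕ} {s t : List ℕ} :
    LeftOf (a :: s) (b :: t) ↔ a < b ∨ a = b ∧ LeftOf s t := by
  constructor
  · rintro ⟨ρ, x, y, hxy, hs, ht⟩
    cases ρ with
    | nil =>
      simp only [List.nil_append, List.cons_prefix_cons] at hs ht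
      left
      omega
    | cons c ρ =>
      simp only [List.cons_append, List.cons_prefix_cons] at hs ht
      exact Or.inr ⟨hs.1.symm.trans ht.1, ρ, x, y, hxy, hs.2, ht.2⟩
  · rintro (h | ⟨rfl, ρ, x, y, hxy, hs, ht⟩)
    · exact ⟨[], a, b, h, by simp, by simp⟩
    · exact ⟨a :: ρ, x, y, hxy, by simpa using hs, by simpa using ht⟩

theorem not_KBlt_nil_left (t : List ℕ) : ¬ KBlt [] t := by
  rintro (⟨h, hne⟩ | h)
  · exact hne (List.prefix_nil.mp h).symm
  · exact not_leftOf_nil_left t h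

theorem KBlt_cons_cons {a b : ℕ} {s t : List ℕ} :
    KBlt (a :: s) (b :: t) ↔ a < b ∨ a = b ∧ KBlt s t := by
  unfold KBlt
  rw [leftOf_cons_cons, List.cons_prefix_cons]
  grind

/-- Nothing lies to the left of a sequence of zeros. -/
theorem not_leftOf_replicate_zero (s : List ℕ) (k : ℕ) :
    ¬ LeftOf s (List.replicate k 0) := by
  rintro ⟨ρ, x, y, hxy, -, h⟩
  have hy : y ∈ List.replicate k 0 := h.subset (by simp)
  have := List.eq_of_mem_replicate hy
  omega

/-- A sequence strictly between `τ⌢⟨x⟩` and `τ⌢⟨x+1⟩⌢0ᵏ` properly extends the latter. -/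
theorem prefix_of_KBlt_between {τ υ : List ℕ} {x k : ℕ} (h₁ : KBlt (τ ++ [x]) υ)
    (h₂ : KBlt υ ((τ ++ [x + 1]) ++ List.replicate k 0)) :
    (τ ++ [x + 1]) ++ List.replicate k 0 <+: υ ∧ υ ≠ (τ ++ [x + 1]) ++ List.replicate k 0 := by
  refine h₂.resolve_right fun hl => ?_
  clear h₂
  induction τ generalizing υ with
  | nil =>
    cases υ with
    | nil => exact not_leftOf_nil_left _ hl
    | cons b u =>
      simp only [List.nil_append, List.cons_append] at h₁ hl
      rw [KBlt_cons_cons] at h₁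
      rw [leftOf_cons_cons] at hl
      have hb := h₁.resolve_right fun h => not_KBlt_nil_left u h.2
      rcases hl with hl | ⟨-, hl⟩
      · omega
      · exact not_leftOf_replicate_zero u k hl
  | cons c τ ih =>
    cases υ with
    | nil => exact not_leftOf_nil_left _ hl
    | cons b u =>
      simp only [List.cons_append] at h₁ hl
      rw [KBlt_cons_cons] at h₁
      rw [leftOf_cons_cons] at hl
      rcases h₁ with h₁ | ⟨rfl, h₁⟩
      · rcases hl with hl | ⟨rfl, -⟩ <;> omega
      · rcases hl with hl | ⟨-, hl⟩
        · omega
        · exact ih h₁ hl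

/-- An element of `T⁺` has all its proper initial segments in `T`. -/
theorem mem_of_prefix_of_mem_treePlus {T : Set (List ℕ)} (hT : IsTree T) {σ υ : List ℕ}
    (hυ : υ ∈ treePlus T) (h : σ <+: υ) (hne : υ ≠ σ) : σ ∈ T := by
  rcases hυ with hυ | ⟨ρ, hρ, n, rfl⟩
  · exact hT υ hυ σ h
  · rcases List.prefix_concat_iff.mp h with h | h
    · exact absurd h.symm hne
    · exact hT ρ hρ σ h

/-- If `σ = σ⁻⌢⟨x⟩ ∈ T⁺` (with `σ⁻ ∈ T`) and `k` is least with
`σ⁻⌢⟨x+1⟩⌢0ᵏ ∉ T`, then `σ⁺ := η(σ⁻⌢⟨x+1⟩) = σ⁻⌢⟨x+1⟩⌢0ᵏ` is defined, lies in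
`T⁺ \ T`, and is the immediate successor of `σ` in `T⁺` under the Kleene–Brouwer
order. -/
theorem stmt9 (T : Set (List ℕ)) (hT : IsTree T) (τ : List ℕ) (x : ℕ)
    (hσ : τ ++ [x] ∈ treePlus T) (hτT : τ ∈ T)
    (k : ℕ) (hk : (τ ++ [x + 1]) ++ List.replicate k 0 ∉ T)
    (hmin : ∀ j, j < k → (τ ++ [x + 1]) ++ List.replicate j 0 ∈ T) :
    ((τ ++ [x + 1]) ++ List.replicate k 0) ∈ treePlus T ∧
    ((τ ++ [x + 1]) ++ List.replicate k 0) ∉ T ∧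
    KBlt (τ ++ [x]) ((τ ++ [x + 1]) ++ List.replicate k 0) ∧
    ¬ ∃ υ ∈ treePlus T,
        KBlt (τ ++ [x]) υ ∧ KBlt υ ((τ ++ [x + 1]) ++ List.replicate k 0) := by
  refine ⟨Or.inr ?_, hk, Or.inr ⟨τ, x, x + 1, by omega, List.prefix_rfl,
    List.prefix_append _ _⟩, ?_⟩
  · cases k with
    | zero => exact ⟨τ, hτT, x + 1, by simp⟩
    | succ k =>
      exact ⟨_, hmin k (by omega), 0, by simp [List.replicate_succ']⟩
  · rintro ⟨υ, hυ, h₁, h₂⟩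
    obtain ⟨hp, hne⟩ := prefix_of_KBlt_between h₁ h₂
    exact hk (mem_of_prefix_of_mem_treePlus hT hυ hp hne)
end

section
/- Let U be a tree of finite sequences of natural numbers. Define the partial function l^σ_τ by the recursion: l^σ_τ is undefined unless σ, τ ∈ U⁺ and τ <KB σ; if τ⁻ is not an initial segment of σ then l^σ_τ = l^σ_{τ⁻}; otherwise, if σ is nonempty and σ⁻ is not an initial segment of τ then l^σ_τ = l^{σ⁻}_τ; otherwise (which forces τ⁻ = σ⁻ or τ⁻ = σ) l^σ_τ = l(τ). Then for all σ, τ ∈ U⁺ with τ <KB σ, this recursion terminates (so l^σ_τ is defined), and l^σ_τ = l(ν), where ν is the initial segment of τ of length |σ ⊓ τ| + 1 (so the immediate predecessor ν⁻ of ν equals σ ⊓ τ, the longest common initial segment of σ and τ). -/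
/-- The longest common initial segment of two finite sequences. -/
def listMeet : List ℕ → List ℕ → List ℕ
  | a :: s, b :: t => if a = b then a :: listMeet s t else []
  | _, _ => []

/-- `l(ρ) = Σ_{i<|ρ|} 4(ρ(i)+1)`. -/
def lval (ρ : List ℕ) : ℕ := (ρ.map (fun x => 4 * (x + 1))).sum

/-- The recursion defining the copy-length function `l^σ_τ`, as a graph:
`LRel U σ τ n` holds iff the recursion, starting from `(σ, τ)`, terminates with
value `n`.  It is only ever invoked for `σ, τ ∈ U⁺` with `τ <KB σ`; `τ⁻` and `σ⁻`
are implemented by `List.dropLast`. -/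
inductive LRel (U : Set (List ℕ)) : List ℕ → List ℕ → ℕ → Prop
  | dropTau {σ τ : List ℕ} {n : ℕ}
      (h1 : σ ∈ treePlus U) (h2 : τ ∈ treePlus U) (h3 : KBlt τ σ)
      (h4 : ¬ τ.dropLast <+: σ)
      (ih : LRel U σ τ.dropLast n) : LRel U σ τ n
  | dropSigma {σ τ : List ℕ} {n : ℕ}
      (h1 : σ ∈ treePlus U) (h2 : τ ∈ treePlus U) (h3 : KBlt τ σ)
      (h4 : τ.dropLast <+: σ) (h5 : σ ≠ []) (h6 : ¬ σ.dropLast <+: τ)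
      (ih : LRel U σ.dropLast τ n) : LRel U σ τ n
  | base {σ τ : List ℕ}
      (h1 : σ ∈ treePlus U) (h2 : τ ∈ treePlus U) (h3 : KBlt τ σ)
      (h4 : τ.dropLast <+: σ) (h5 : ¬ (σ ≠ [] ∧ ¬ σ.dropLast <+: τ)) :
      LRel U σ τ (lval τ)

theorem mem_treePlus_of_prefix {U : Set (List ℕ)} (hU : IsTree U) {σ τ : List ℕ}
    (hσ : σ ∈ treePlus U) (h : τ <+: σ) : τ ∈ treePlus U := by
  rcases hσ with hσ | ⟨ρ, hρ, n, rfl⟩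
  · exact Or.inl (hU σ hσ τ h)
  · rcases List.prefix_concat_iff.1 h with rfl | h
    · exact Or.inr ⟨ρ, hρ, n, rfl⟩
    · exact Or.inl (hU ρ hρ τ h)

/-- The Kleene–Brouwer order in terms of the first entry after the common part. -/
theorem kblt_iff {σ τ : List ℕ} :
    KBlt τ σ ↔ ∃ ρ b t s, τ = ρ ++ b :: t ∧ σ = ρ ++ s ∧ ∀ a ∈ s.head?, b < a := by
  constructor
  · rintro (⟨⟨t, rfl⟩, hne⟩ | ⟨ρ, b, a, hba, ⟨t, rfl⟩, ⟨s, rfl⟩⟩)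
    · cases t with
      | nil => simp at hne
      | cons b t => exact ⟨σ, b, t, [], by simp⟩
    · exact ⟨ρ, b, t, a :: s, by simp, by simp, by simpa using hba⟩
  · rintro ⟨ρ, b, t, s, rfl, rfl, h⟩
    cases s with
    | nil => exact Or.inl (by simp)
    | cons a s => exact Or.inr ⟨ρ, b, a, by simpa using h, by simp, by simp⟩

theorem listMeet_append {ρ t s : List ℕ} {b : ℕ} (h : ∀ a ∈ s.head?, b < a) :
    listMeet (ρ ++ s) (ρ ++ b :: t) = ρ := by
  induction ρ with
  | nil =>
    cases s with
    | nil => simp [listMeet]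
    | cons a s =>
      have : b < a := by simpa using h
      simp [listMeet, this.ne']
  | cons c ρ ih => simp [listMeet, ih]

theorem dropLast_prefix_iff_eq_nil {ρ t s : List ℕ} {b : ℕ} (h : ∀ a ∈ s.head?, b < a) :
    (ρ ++ b :: t).dropLast <+: ρ ++ s ↔ t = [] := by
  cases t with
  | nil => simp
  | cons c t =>
    cases s with
    | nil =>
      suffices ¬ ρ ++ b :: (c :: t).dropLast <+: ρ by
        simpa [List.dropLast_append_of_ne_nil] using this
      intro hp
      simpa using hp.length_le
    | cons a s =>
      have : b < a := by simpa using h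
      simp [List.dropLast_append_of_ne_nil, List.cons_prefix_cons, this.ne]

theorem dropLast_prefix_iff_tail_eq_nil {ρ s t : List ℕ} {b : ℕ} (h : ∀ a ∈ s.head?, b < a) :
    (ρ ++ s).dropLast <+: ρ ++ b :: t ↔ s.tail = [] := by
  cases s with
  | nil => simpa using (List.dropLast_prefix ρ).trans (List.prefix_append ρ _)
  | cons a s =>
    have : b < a := by simpa using h
    cases s with
    | nil => simp
    | cons c s => simp [List.dropLast_append_of_ne_nil, List.cons_prefix_cons, this.ne']

/-- Termination with the expected value. -/
theorem lRel_append {U : Set (List ℕ)} (hU : IsTree U) {ρ s t : List ℕ} {b : ℕ}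
    (hσ : ρ ++ s ∈ treePlus U) (hτ : ρ ++ b :: t ∈ treePlus U) (h : ∀ a ∈ s.head?, b < a) :
    LRel U (ρ ++ s) (ρ ++ b :: t) (lval (ρ ++ [b])) := by
  have hlt : KBlt (ρ ++ b :: t) (ρ ++ s) := kblt_iff.2 ⟨ρ, b, t, s, rfl, rfl, h⟩
  induction t using List.reverseRecOn with
  | append_singleton t c ih =>
    have e : (ρ ++ b :: (t ++ [c])).dropLast = ρ ++ b :: t := by
      rw [← List.cons_append, ← List.append_assoc, List.dropLast_concat]
    refine .dropTau hσ hτ hlt (by rw [dropLast_prefix_iff_eq_nil h]; simp) ?_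
    rw [e]
    exact ih (mem_treePlus_of_prefix hU hτ (e ▸ List.dropLast_prefix _))
      (kblt_iff.2 ⟨ρ, b, t, s, rfl, rfl, h⟩)
  | nil =>
    induction s using List.reverseRecOn with
    | nil => exact .base hσ hτ hlt (by simp) (by rw [dropLast_prefix_iff_tail_eq_nil h]; simp)
    | append_singleton s c ih =>
      by_cases hs : s = []
      · subst hs
        exact .base hσ hτ hlt (by simp) (by simp)
      · have e : (ρ ++ (s ++ [c])).dropLast = ρ ++ s := by
          rw [← List.append_assoc, List.dropLast_concat]
        have h' : ∀ a ∈ s.head?, b < a := by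
          rwa [List.head?_append_of_ne_nil _ hs] at h
        refine .dropSigma hσ hτ hlt (by simp) (by simp) ?_ ?_
        · rw [dropLast_prefix_iff_tail_eq_nil h, List.tail_append_of_ne_nil hs]
          simp
        · rw [e]
          exact ih (mem_treePlus_of_prefix hU hσ (e ▸ List.dropLast_prefix _)) h'
            (kblt_iff.2 ⟨ρ, b, [], s, rfl, rfl, h'⟩)

theorem LRel.eq_lval {U : Set (List ℕ)} {σ τ : List ℕ} {n : ℕ} (hn : LRel U σ τ n)
    {ρ s t : List ℕ} {b : ℕ} (eσ : σ = ρ ++ s) (eτ : τ = ρ ++ b :: t)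
    (h : ∀ a ∈ s.head?, b < a) : n = lval (ρ ++ [b]) := by
  induction hn generalizing s t with
  | dropTau _ _ _ h4 _ ih =>
    subst eσ eτ
    rw [dropLast_prefix_iff_eq_nil h] at h4
    exact ih rfl (t := t.dropLast) (by
      rw [List.dropLast_append_of_ne_nil (by simp), List.dropLast_cons_of_ne_nil h4]) h
  | dropSigma _ _ _ _ _ h6 _ ih =>
    subst eσ eτ
    rw [dropLast_prefix_iff_tail_eq_nil h] at h6
    rcases s with _ | ⟨a, _ | ⟨c, s⟩⟩
    · simp at h6
    · simp at h6
    · exact ih (s := a :: (c :: s).dropLast) (by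
        simp [List.dropLast_append_of_ne_nil]) rfl (by simpa using h)
  | base _ _ _ h4 _ =>
    subst eσ eτ
    rw [dropLast_prefix_iff_eq_nil h] at h4
    rw [h4]

/-- For `σ, τ ∈ U⁺` with `τ <KB σ`, the recursion defining `l^σ_τ` terminates, its
value is unique, and `l^σ_τ = l(ν)` where `ν` is the initial segment of `τ` of
length `|σ ⊓ τ| + 1` (so that `ν⁻ = σ ⊓ τ`). -/
theorem stmt10 (U : Set (List ℕ)) (hU : IsTree U) (σ τ : List ℕ)
    (hσ : σ ∈ treePlus U) (hτ : τ ∈ treePlus U) (hlt : KBlt τ σ) :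
    LRel U σ τ (lval (τ.take ((listMeet σ τ).length + 1))) ∧
    (∀ n, LRel U σ τ n → n = lval (τ.take ((listMeet σ τ).length + 1))) ∧
    (τ.take ((listMeet σ τ).length + 1)).dropLast = listMeet σ τ := by
  obtain ⟨ρ, b, t, s, rfl, rfl, h⟩ := kblt_iff.1 hlt
  have e : (ρ ++ b :: t).take (ρ.length + 1) = ρ ++ [b] := by
    simp [List.take_append]
  rw [listMeet_append h, e]
  exact ⟨lRel_append hU hσ hτ h, fun n hn => hn.eq_lval rfl rfl h, by simp⟩
end
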